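/- arXiv:2406.05516 — 4 statements merged into one kernel-verified Lean document; each statement's English description precedes it below -/
import Mathlib

section
/- Fix positive integers n, K, d, a real β > 0, feature vectors u : Fin n → (Fin d → ℝ), and one-hot labels y : Fin n → Fin K → ℝ where for each i there is exactly one class c i with y i (c i) = 1 and y i k = 0 otherwise. Let g* be any predictor with g*(u_i)_k = p*_{ik} for all i, k, where p*_{ik} = (∑_{i'} y_{i'k} · 1[u_{i'} = u_i]) / (#{i' : u_{i'} = u_i}). Then for every predictor g satisfying g(u_i)_{c i} > 0 for all i, one has L(g*) ≤ L(g). In particular, g* is a global minimizer of L among such predictors. -/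
open scoped Classical

/-- Conditional-frequency values: `pstar u y i k` is the fraction of samples `i'`
with the same feature vector as `i` that have label `k`. -/
noncomputable def pstar {n d K : ℕ} (u : Fin n → Fin d → ℝ)
    (y : Fin n → Fin K → ℝ) (i : Fin n) (k : Fin K) : ℝ :=
  (∑ i', y i' k * (if u i' = u i then (1 : ℝ) else 0)) /
    ((Finset.univ.filter fun i' => u i' = u i).card : ℝ)

/-- The calibrated loss: cross-entropy plus `β` times the bin-free class-wise
calibration term. -/
noncomputable def loss {n d K : ℕ} (β : ℝ) (u : Fin n → Fin d → ℝ)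
    (y : Fin n → Fin K → ℝ) (g : (Fin d → ℝ) → Fin K → ℝ) : ℝ :=
  -((1 / (n : ℝ)) * ∑ i, ∑ k, y i k * Real.log (g (u i) k)) +
    β * ((1 / (K : ℝ)) *
      ∑ k, |(1 / (n : ℝ)) * ∑ i, g (u i) k - (1 / (n : ℝ)) * ∑ i, y i k|)

/-- Averaging a function of the features against the labels or against the conditional
frequencies gives the same result. -/
theorem sum_pstar_mul {n d K : ℕ} (u : Fin n → Fin d → ℝ) (y : Fin n → Fin K → ℝ)
    (f : (Fin d → ℝ) → ℝ) (k : Fin K) :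
    ∑ i, pstar u y i k * f (u i) = ∑ i, y i k * f (u i) := by
  simp only [pstar, Finset.sum_div, Finset.sum_mul]
  rw [Finset.sum_comm]
  refine Finset.sum_congr rfl fun j _ => ?_
  have hcard : ((Finset.univ.filter fun i' => u i' = u j).card : ℝ) ≠ 0 := by
    rw [Nat.cast_ne_zero]
    exact Finset.card_ne_zero_of_mem (Finset.mem_filter.2 ⟨Finset.mem_univ j, rfl⟩)
  have hterm : ∀ i, y j k * (if u j = u i then (1 : ℝ) else 0) /
      ((Finset.univ.filter fun i' => u i' = u i).card : ℝ) * f (u i) =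
      if u i = u j then y j k * f (u j) /
        ((Finset.univ.filter fun i' => u i' = u j).card : ℝ) else 0 := by
    intro i
    by_cases h : u i = u j
    · simp only [h, if_true]
      ring
    · simp [h, Ne.symm h]
  rw [Finset.sum_congr rfl fun i _ => hterm i, ← Finset.sum_filter, Finset.sum_const,
    nsmul_eq_mul]
  field_simp

theorem sum_pstar {n d K : ℕ} (u : Fin n → Fin d → ℝ) (y : Fin n → Fin K → ℝ) (k : Fin K) :
    ∑ i, pstar u y i k = ∑ i, y i k := by
  simpa using sum_pstar_mul u y (fun _ => 1) k

theorem exists_ne_zero_of_pstar_ne_zero {n d K : ℕ} {u : Fin n → Fin d → ℝ}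
    {y : Fin n → Fin K → ℝ} {i : Fin n} {k : Fin K} (h : pstar u y i k ≠ 0) :
    ∃ j, u j = u i ∧ y j k ≠ 0 := by
  contrapose! h
  rw [pstar, Finset.sum_eq_zero, zero_div]
  intro j _
  by_cases hj : u j = u i
  · simp [h j hj]
  · simp [hj]

/-- The pointwise form of Gibbs' inequality. -/
theorem mul_log_sub_mul_log_le_sub {p q : ℝ} (hp : 0 ≤ p) (hq : 0 ≤ q) (h : p ≠ 0 → 0 < q) :
    p * Real.log q - p * Real.log p ≤ q - p := by
  rcases hp.eq_or_lt with rfl | hp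
  · simpa using hq
  · have hq := h hp.ne'
    calc p * Real.log q - p * Real.log p = p * Real.log (q / p) := by
          rw [Real.log_div hq.ne' hp.ne', mul_sub]
      _ ≤ p * (q / p - 1) :=
          mul_le_mul_of_nonneg_left (Real.log_le_sub_one_of_pos (div_pos hq hp)) hp.le
      _ = q - p := by field_simp

/-- Any predictor `g*` that outputs the conditional frequencies `p*` on the training
features attains a loss no larger than every predictor positive on the true labels. -/
theorem pstar_is_global_minimizer (n K d : ℕ) (hn : 0 < n) (hK : 0 < K) (hd : 0 < d)
    (β : ℝ) (hβ : 0 < β)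
    (u : Fin n → Fin d → ℝ) (y : Fin n → Fin K → ℝ) (c : Fin n → Fin K)
    (hy : ∀ i, y i (c i) = 1 ∧ ∀ k, k ≠ c i → y i k = 0)
    (gstar : (Fin d → ℝ) → Fin K → ℝ)
    (hgstar0 : ∀ x k, 0 ≤ gstar x k) (hgstar1 : ∀ x, ∑ k, gstar x k = 1)
    (hgstar : ∀ i k, gstar (u i) k = pstar u y i k) :
    ∀ g : (Fin d → ℝ) → Fin K → ℝ,
      (∀ x k, 0 ≤ g x k) → (∀ x, ∑ k, g x k = 1) →
      (∀ i, 0 < g (u i) (c i)) →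
      loss β u y gstar ≤ loss β u y g := by
  intro g hg0 hg1 hgc
  have hpos : ∀ i k, gstar (u i) k ≠ 0 → 0 < g (u i) k := by
    intro i k h
    rw [hgstar] at h
    obtain ⟨j, hj, hyj⟩ := exists_ne_zero_of_pstar_ne_zero h
    have hk : k = c j := by
      by_contra hk
      exact hyj ((hy j).2 k hk)
    rw [← hj, hk]
    exact hgc j
  have hswap : ∀ f : (Fin d → ℝ) → Fin K → ℝ,
      ∑ i, ∑ k, y i k * f (u i) k = ∑ i, ∑ k, gstar (u i) k * f (u i) k := by
    intro f
    rw [Finset.sum_comm, Finset.sum_comm (f := fun i k => gstar (u i) k * f (u i) k)]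
    refine Finset.sum_congr rfl fun k _ => ?_
    simp only [hgstar]
    exact (sum_pstar_mul u y (fun x => f x k) k).symm
  have hce : ∑ i, ∑ k, y i k * Real.log (g (u i) k) ≤
      ∑ i, ∑ k, y i k * Real.log (gstar (u i) k) := by
    rw [hswap fun x k => Real.log (g x k), hswap fun x k => Real.log (gstar x k)]
    refine Finset.sum_le_sum fun i _ => ?_
    rw [← sub_nonpos, ← Finset.sum_sub_distrib]
    calc _ ≤ ∑ k, (g (u i) k - gstar (u i) k) := Finset.sum_le_sum fun k _ =>
          mul_log_sub_mul_log_le_sub (hgstar0 _ k) (hg0 _ k) (hpos i k)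
      _ = 0 := by rw [Finset.sum_sub_distrib, hg1, hgstar1, sub_self]
  have hcal : ∑ k, |(1 / (n : ℝ)) * ∑ i, gstar (u i) k - (1 / (n : ℝ)) * ∑ i, y i k| = 0 := by
    refine Finset.sum_eq_zero fun k _ => ?_
    simp only [hgstar, sum_pstar, sub_self, abs_zero]
  unfold loss
  rw [hcal, mul_zero, mul_zero]
  refine add_le_add (neg_le_neg (mul_le_mul_of_nonneg_left hce (by positivity))) ?_
  positivity
end

section
/- Fix positive integers n, K, d, a real β > 0, feature vectors u : Fin n → (Fin d → ℝ), and one-hot labels y : Fin n → Fin K → ℝ where for each i there is exactly one class c i with y i (c i) = 1 and y i k = 0 otherwise. Let p*_{ik} = (∑_{i'} y_{i'k} · 1[u_{i'} = u_i]) / (#{i' : u_{i'} = u_i}) and let g* be any predictor with g*(u_i)_k = p*_{ik} for all i, k. Then the minimum loss value satisfies L(g*) = -(1/n) ∑_i log (p*_{i, c i}) = (1/n) ∑_{v ∈ V} (#{i : u_i = v}) * H(q_v), where V is the (finite) set of distinct values among u_1, …, u_n, q_v : Fin K → ℝ is given by q_v(k) = (∑_{i : u_i = v} y_{ik}) / (#{i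 : u_i = v}), and H(q) = -∑_k q k * log (q k) is the Shannon entropy (with the convention 0 * log 0 = 0). -/
open scoped Classical

/-- Shannon entropy of a finite probability vector (with the convention
`0 * log 0 = 0`, which holds automatically for real multiplication). -/
noncomputable def shannonEntropy {K : ℕ} (q : Fin K → ℝ) : ℝ :=
  -∑ k, q k * Real.log (q k)

/-- The empirical conditional label distribution given the feature value `v`. -/
noncomputable def condDist {n d K : ℕ} (u : Fin n → Fin d → ℝ)
    (y : Fin n → Fin K → ℝ) (v : Fin d → ℝ) (k : Fin K) : ℝ :=
  (∑ i ∈ Finset.univ.filter fun i => u i = v, y i k) /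
    ((Finset.univ.filter fun i => u i = v).card : ℝ)

theorem pstar_eq_condDist {n d K : ℕ} (u : Fin n → Fin d → ℝ)
    (y : Fin n → Fin K → ℝ) (i : Fin n) (k : Fin K) :
    pstar u y i k = condDist u y (u i) k := by
  simp [pstar, condDist, Finset.sum_filter]

theorem card_mul_condDist {n d K : ℕ} (u : Fin n → Fin d → ℝ)
    (y : Fin n → Fin K → ℝ) (v : Fin d → ℝ) (k : Fin K) :
    ((Finset.univ.filter fun i => u i = v).card : ℝ) * condDist u y v k =
      ∑ i ∈ Finset.univ.filter fun i => u i = v, y i k := by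
  unfold condDist
  rcases Finset.eq_empty_or_nonempty (Finset.univ.filter fun i => u i = v) with h | h
  · simp [h]
  · exact mul_div_cancel₀ _ (Nat.cast_ne_zero.mpr h.card_pos.ne')

theorem sum_eq_sum_image_fiber {n d : ℕ} (u : Fin n → Fin d → ℝ) (f : Fin n → ℝ) :
    ∑ i, f i =
      ∑ v ∈ Finset.univ.image u, ∑ i ∈ Finset.univ.filter fun i => u i = v, f i :=
  (Finset.sum_fiberwise_of_maps_to
    (fun i _ => Finset.mem_image_of_mem u (Finset.mem_univ i)) f).symm

/-- Averaging labels against a function of the features only depends on the labels through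
their conditional distributions. -/
theorem sum_label_mul_eq {n d K : ℕ} (u : Fin n → Fin d → ℝ)
    (y : Fin n → Fin K → ℝ) (F : (Fin d → ℝ) → ℝ) (k : Fin K) :
    ∑ i, y i k * F (u i) =
      ∑ v ∈ Finset.univ.image u,
        ((Finset.univ.filter fun i => u i = v).card : ℝ) * (condDist u y v k * F v) := by
  rw [sum_eq_sum_image_fiber u]
  refine Finset.sum_congr rfl fun v _ => ?_
  rw [← mul_assoc, card_mul_condDist, Finset.sum_mul]
  refine Finset.sum_congr rfl fun i hi => ?_
  rw [(Finset.mem_filter.mp hi).2]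

theorem sum_condDist_eq_sum_label {n d K : ℕ} (u : Fin n → Fin d → ℝ)
    (y : Fin n → Fin K → ℝ) (k : Fin K) :
    ∑ i, condDist u y (u i) k = ∑ i, y i k := by
  have h := sum_label_mul_eq u y (fun _ => 1) k
  simp only [mul_one] at h
  rw [h, sum_eq_sum_image_fiber u]
  refine Finset.sum_congr rfl fun v _ => ?_
  rw [← nsmul_eq_mul, ← Finset.sum_const]
  refine Finset.sum_congr rfl fun i hi => ?_
  rw [(Finset.mem_filter.mp hi).2]

/-- The minimum loss value: a predictor `g*` outputting the conditional frequencies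
`p*` has loss `-(1/n) ∑ i, log (p*_{i, c i})`, which equals the average (weighted by
feature-value counts) Shannon entropy of the empirical conditional label
distributions. -/
theorem min_loss_value (n K d : ℕ) (hn : 0 < n) (hK : 0 < K) (hd : 0 < d)
    (β : ℝ) (hβ : 0 < β)
    (u : Fin n → Fin d → ℝ) (y : Fin n → Fin K → ℝ) (c : Fin n → Fin K)
    (hy : ∀ i, y i (c i) = 1 ∧ ∀ k, k ≠ c i → y i k = 0)
    (gstar : (Fin d → ℝ) → Fin K → ℝ)
    (hgstar0 : ∀ x k, 0 ≤ gstar x k) (hgstar1 : ∀ x, ∑ k, gstar x k = 1)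
    (hgstar : ∀ i k, gstar (u i) k = pstar u y i k) :
    loss β u y gstar = -((1 / (n : ℝ)) * ∑ i, Real.log (pstar u y i (c i))) ∧
    loss β u y gstar =
      (1 / (n : ℝ)) * ∑ v ∈ Finset.univ.image u,
        ((Finset.univ.filter fun i => u i = v).card : ℝ) *
          shannonEntropy (condDist u y v) := by
  have hg : ∀ i k, gstar (u i) k = condDist u y (u i) k := fun i k => by
    rw [hgstar, pstar_eq_condDist]
  have hloss : loss β u y gstar =
      -((1 / (n : ℝ)) * ∑ i, ∑ k, y i k * Real.log (condDist u y (u i) k)) := by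
    simp [loss, hg, sum_condDist_eq_sum_label]
  refine ⟨?_, ?_⟩
  · rw [hloss]
    congr 2
    refine Finset.sum_congr rfl fun i _ => ?_
    rw [Finset.sum_eq_single (c i) (fun k _ hk => by rw [(hy i).2 k hk, zero_mul])
      (fun h => absurd (Finset.mem_univ _) h), (hy i).1, one_mul, pstar_eq_condDist]
  · rw [hloss, Finset.sum_comm, Finset.sum_congr rfl fun k _ =>
      sum_label_mul_eq u y (fun v => Real.log (condDist u y v k)) k, Finset.sum_comm]
    simp only [shannonEntropy, ← Finset.mul_sum, mul_neg, Finset.sum_neg_distrib]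
end

section
/- Let K ≥ 2 be an integer and a : Fin K → ℝ with a j > 0 for all j. Let T = {x : Fin (K-1) → ℝ | (∀ j, 0 < x j) ∧ ∑_j x j < 1} be the open standard simplex in ℝ^{K-1}. Then ∫_{T} (∏_{j < K-1} (x j)^{a j − 1}) * (1 − ∑_j x j)^{a (K-1) − 1} dx = (∏_{j < K} Γ(a j)) / Γ(∑_{j < K} a j), where the integral is with respect to Lebesgue measure on ℝ^{K-1} and Γ is the Gamma function. -/
open MeasureTheory

open Set in
/-- The beta integral, rescaled to the interval `(0, r)`. -/
theorem lintegral_rpow_mul_sub_rpow {u v r : ℝ} (hu : 0 < u) (hv : 0 < v) (hr : 0 < r) :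
    ∫⁻ t in Ioo 0 r, ENNReal.ofReal (t ^ (u - 1) * (r - t) ^ (v - 1)) =
      ENNReal.ofReal (r ^ (u + v - 1) * (Real.Gamma u * Real.Gamma v / Real.Gamma (u + v))) := by
  have hB := ProbabilityTheory.beta_pos hu hv
  have hone : ∫⁻ t in Ioo (0 : ℝ) 1, ENNReal.ofReal
      (1 / ProbabilityTheory.beta u v * t ^ (u - 1) * (1 - t) ^ (v - 1)) = 1 := by
    rw [← ProbabilityTheory.lintegral_betaPDF, ProbabilityTheory.lintegral_betaPDF_eq_one hu hv]
  have himage : (fun x => r * x) '' Ioo (0 : ℝ) 1 = Ioo 0 r := by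
    simpa using image_mul_left_Ioo hr 0 1
  rw [← himage, lintegral_image_eq_lintegral_abs_deriv_mul (f' := fun _ => r) measurableSet_Ioo
    (fun x _ => by simpa using ((hasDerivAt_id x).const_mul r).hasDerivWithinAt)
    (mul_right_injective₀ hr.ne').injOn]
  rw [← mul_one (ENNReal.ofReal (r ^ (u + v - 1) * _)), ← hone,
    ← lintegral_const_mul' _ _ ENNReal.ofReal_ne_top]
  refine setLIntegral_congr_fun measurableSet_Ioo fun t ht => ?_
  have hsplit : r ^ (u + v - 1) = r * (r ^ (u - 1) * r ^ (v - 1)) := by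
    rw [Real.rpow_sub_one hr.ne', Real.rpow_sub_one hr.ne', Real.rpow_sub_one hr.ne',
      Real.rpow_add hr]
    field_simp
  have hsub : r - r * t = r * (1 - t) := by ring
  change ENNReal.ofReal |r| * _ = _
  rw [abs_of_pos hr, ← ENNReal.ofReal_mul hr.le, ← ENNReal.ofReal_mul (by positivity), hsplit,
    hsub, Real.mul_rpow hr.le ht.1.le, Real.mul_rpow hr.le (sub_nonneg.2 ht.2.le)]
  change _ = ENNReal.ofReal (_ * ProbabilityTheory.beta u v * _)
  congr 1
  field_simp

/-- The open simplex of points with positive coordinates of sum less than `r`. -/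
def openCornerSimplex (n : ℕ) (r : ℝ) : Set (Fin n → ℝ) :=
  {x | (∀ j, 0 < x j) ∧ ∑ j, x j < r}

theorem measurableSet_openCornerSimplex (n : ℕ) (r : ℝ) :
    MeasurableSet (openCornerSimplex n r) := by
  have : openCornerSimplex n r = (⋂ j, {x | 0 < x j}) ∩ {x | ∑ j, x j < r} := by
    ext x
    simp [openCornerSimplex]
  rw [this]
  exact (MeasurableSet.iInter fun j => measurableSet_lt (by fun_prop) (by fun_prop)).inter
    (measurableSet_lt (by fun_prop) (by fun_prop))

theorem cons_mem_openCornerSimplex_iff {n : ℕ} {r t : ℝ} {y : Fin n → ℝ} :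
    (Fin.cons t y : Fin (n + 1) → ℝ) ∈ openCornerSimplex (n + 1) r ↔
      t ∈ Set.Ioo 0 r ∧ y ∈ openCornerSimplex n (r - t) := by
  simp only [openCornerSimplex, Set.mem_ofPred_eq, Fin.forall_fin_succ, Fin.sum_univ_succ,
    Fin.cons_zero, Fin.cons_succ, Set.mem_Ioo]
  constructor
  · rintro ⟨⟨ht, hy⟩, hsum⟩
    have := Finset.sum_nonneg fun j (_ : j ∈ Finset.univ) => (hy j).le
    exact ⟨⟨ht, by linarith⟩, hy, by linarith⟩
  · rintro ⟨⟨ht, -⟩, hy, hsum⟩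
    exact ⟨⟨ht, hy⟩, by linarith⟩

/-- Fubini over an open simplex, splitting off the first coordinate. -/
theorem setLIntegral_openCornerSimplex_succ {n : ℕ} (r : ℝ) {f : (Fin (n + 1) → ℝ) → ENNReal}
    (hf : Measurable f) :
    ∫⁻ x in openCornerSimplex (n + 1) r, f x =
      ∫⁻ t in Set.Ioo 0 r, ∫⁻ y in openCornerSimplex n (r - t), f (Fin.cons t y) := by
  classical
  have hmeas := hf.indicator (measurableSet_openCornerSimplex (n + 1) r)
  have he := (volume_preserving_piFinSuccAbove (fun _ : Fin (n + 1) => ℝ) 0).symm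
  rw [← lintegral_indicator (measurableSet_openCornerSimplex _ _), ← he.lintegral_comp hmeas,
    Measure.volume_eq_prod, lintegral_prod _ (by exact (hmeas.comp he.measurable).aemeasurable),
    ← lintegral_indicator measurableSet_Ioo]
  refine lintegral_congr fun t => ?_
  have hcons (y : Fin n → ℝ) :
      (MeasurableEquiv.piFinSuccAbove (fun _ : Fin (n + 1) => ℝ) 0).symm (t, y) = Fin.cons t y :=
    Fin.insertNth_zero' _ _
  by_cases ht : t ∈ Set.Ioo 0 r
  · rw [Set.indicator_of_mem ht, ← lintegral_indicator (measurableSet_openCornerSimplex _ _)]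
    refine lintegral_congr fun y => ?_
    rw [hcons]
    simp only [Set.indicator_apply, cons_mem_openCornerSimplex_iff, ht, true_and]
  · rw [Set.indicator_of_notMem ht]
    simp only [hcons, Set.indicator_apply, cons_mem_openCornerSimplex_iff, ht, false_and,
      if_false, lintegral_zero]

theorem lintegral_dirichlet (n : ℕ) (a : Fin n → ℝ) (ha : ∀ j, 0 < a j) {b : ℝ} (hb : 0 < b)
    {r : ℝ} (hr : 0 < r) :
    ∫⁻ x in openCornerSimplex n r,
        ENNReal.ofReal ((∏ j, x j ^ (a j - 1)) * (r - ∑ j, x j) ^ (b - 1)) =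
      ENNReal.ofReal (r ^ (∑ j, a j + b - 1) *
        ((∏ j, Real.Gamma (a j)) * Real.Gamma b / Real.Gamma (∑ j, a j + b))) := by
  induction n generalizing r with
  | zero =>
    have huniv : openCornerSimplex 0 r = Set.univ := by
      ext x
      simp [openCornerSimplex, hr]
    simp [huniv, lintegral_unique, (Real.Gamma_pos_of_pos hb).ne', volume_pi]
  | succ n ih =>
    set c := ∑ j : Fin n, a j.succ + b with hc_def
    have hc : 0 < c := add_pos_of_nonneg_of_pos (Finset.sum_nonneg fun j _ => (ha _).le) hb
    have hΓc := Real.Gamma_pos_of_pos hc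
    set C := (∏ j : Fin n, Real.Gamma (a j.succ)) * Real.Gamma b / Real.Gamma c with hC_def
    have hC : 0 ≤ C := div_nonneg (mul_nonneg (Finset.prod_nonneg fun j _ =>
      (Real.Gamma_pos_of_pos (ha _)).le) (Real.Gamma_pos_of_pos hb).le) hΓc.le
    have hinner : ∀ t ∈ Set.Ioo 0 r, ∫⁻ y in openCornerSimplex n (r - t), ENNReal.ofReal
          ((∏ j, (Fin.cons t y : Fin (n + 1) → ℝ) j ^ (a j - 1)) *
            (r - ∑ j, (Fin.cons t y : Fin (n + 1) → ℝ) j) ^ (b - 1)) =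
        ENNReal.ofReal C * ENNReal.ofReal (t ^ (a 0 - 1) * (r - t) ^ (c - 1)) := by
      intro t ht
      have ht0 : 0 ≤ t ^ (a 0 - 1) := Real.rpow_nonneg ht.1.le _
      simp only [Fin.prod_univ_succ, Fin.sum_univ_succ, Fin.cons_zero, Fin.cons_succ, mul_assoc,
        ← sub_sub]
      simp_rw [ENNReal.ofReal_mul ht0]
      rw [lintegral_const_mul' _ _ ENNReal.ofReal_ne_top,
        ih (fun j => a j.succ) (fun j => ha _) (sub_pos.2 ht.2), ← hc_def, ← hC_def,
        ENNReal.ofReal_mul' hC]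
      ring
    rw [setLIntegral_openCornerSimplex_succ r (by fun_prop),
      setLIntegral_congr_fun measurableSet_Ioo hinner,
      lintegral_const_mul' _ _ ENNReal.ofReal_ne_top,
      lintegral_rpow_mul_sub_rpow (ha 0) hc hr, ← ENNReal.ofReal_mul hC,
      Fin.sum_univ_succ, Fin.prod_univ_succ, add_assoc, ← hc_def, hC_def]
    congr 1
    field_simp

/-- **Dirichlet normalizing constant.** The integral of the Dirichlet density kernel
over the open standard simplex in `ℝ^{K-1}` equals `(∏ j, Γ(a j)) / Γ(∑ j, a j)`. -/
theorem dirichlet_normalizing_constant (K : ℕ) (hK : 2 ≤ K)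
    (a : Fin K → ℝ) (ha : ∀ j, 0 < a j) :
    (∫ x : Fin (K - 1) → ℝ in
        {x : Fin (K - 1) → ℝ | (∀ j, 0 < x j) ∧ ∑ j, x j < 1},
      (∏ j : Fin (K - 1), x j ^ (a (j.castLE (Nat.sub_le K 1)) - 1)) *
        (1 - ∑ j, x j) ^ (a ⟨K - 1, by omega⟩ - 1)) =
    (∏ j, Real.Gamma (a j)) / Real.Gamma (∑ j, a j) := by
  obtain ⟨n, rfl⟩ : ∃ n, K = n + 1 := ⟨K - 1, by omega⟩
  change ∫ x : Fin n → ℝ in openCornerSimplex n 1,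
    (∏ j : Fin n, x j ^ (a j.castSucc - 1)) * (1 - ∑ j, x j) ^ (a (Fin.last n) - 1) = _
  rw [integral_eq_lintegral_of_nonneg_ae]
  · rw [lintegral_dirichlet n (fun j => a j.castSucc) (fun j => ha _) (ha _) one_pos,
      Real.one_rpow, one_mul, Fin.prod_univ_castSucc, Fin.sum_univ_castSucc,
      ENNReal.toReal_ofReal]
    rw [← Fin.prod_univ_castSucc fun j => Real.Gamma (a j), ← Fin.sum_univ_castSucc a]
    exact div_nonneg (Finset.prod_nonneg fun j _ => (Real.Gamma_pos_of_pos (ha j)).le)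
      (Real.Gamma_nonneg_of_nonneg (Finset.sum_nonneg fun j _ => (ha j).le))
  · refine ae_restrict_of_forall_mem (measurableSet_openCornerSimplex n 1) fun x hx => ?_
    exact mul_nonneg (Finset.prod_nonneg fun j _ => Real.rpow_nonneg (hx.1 j).le _)
      (Real.rpow_nonneg (sub_nonneg.2 hx.2.le) _)
  · exact Measurable.aestronglyMeasurable (by fun_prop)
end

section
/- Let K ≥ 2 be an integer, a : Fin K → ℝ with a j > 0 for all j, and T = {x : Fin (K-1) → ℝ | (∀ j, 0 < x j) ∧ ∑_j x j < 1}. For x ∈ T write π(x) : Fin K → ℝ for the probability vector with π(x) j = x j for j < K−1 and π(x) (K−1) = 1 − ∑_j x j. Then for every index k < K, ∫_{T} π(x) k * ∏_{j < K} (π(x) j)^{a j − 1} dx = (a k / ∑_{j < K} a j) * ∫_{T} ∏_{j < K} (π(x) j)^{a j − 1} dx, where both integrals are with respect to Lebesgue measure on ℝ^{K-1}. -/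
open MeasureTheory

/-- The probability vector on `K` categories determined by a point of the open
standard simplex in `ℝ^{K-1}`: the first `K-1` coordinates are those of `x`,
and the last coordinate is `1 - ∑ j, x j`. -/
noncomputable def piVec (K : ℕ) (x : Fin (K - 1) → ℝ) (j : Fin K) : ℝ :=
  if h : (j : ℕ) < K - 1 then x ⟨j, h⟩ else 1 - ∑ j', x j'

/-- The open simplex `{x | 0 < x j, ∑ j, x j < s}`. -/
def openSimplex (n : ℕ) (s : ℝ) : Set (Fin n → ℝ) :=
  {x | (∀ j, 0 < x j) ∧ ∑ j, x j < s}

theorem measurableSet_openSimplex (n : ℕ) (s : ℝ) : MeasurableSet (openSimplex n s) := by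
  have h : openSimplex n s = (⋂ j, {x | 0 < x j}) ∩ {x | ∑ j, x j < s} := by
    ext x
    simp [openSimplex]
  rw [h]
  exact (MeasurableSet.iInter fun j => measurableSet_lt measurable_const (by fun_prop)).inter
    (measurableSet_lt (by fun_prop) measurable_const)

theorem openSimplex_eq_empty {n : ℕ} {s : ℝ} (hs : s ≤ 0) : openSimplex n s = ∅ := by
  refine Set.eq_empty_of_forall_notMem fun x hx => ?_
  have := Finset.sum_nonneg fun j (_ : j ∈ Finset.univ) => (hx.1 j).le
  linarith [hx.2]

theorem cons_mem_openSimplex {n : ℕ} {s t : ℝ} {x : Fin n → ℝ} :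
    (Fin.cons t x : Fin (n + 1) → ℝ) ∈ openSimplex (n + 1) s ↔
      0 < t ∧ x ∈ openSimplex n (s - t) := by
  simp only [openSimplex, Set.mem_ofPred_eq, Fin.forall_fin_succ, Fin.cons_zero, Fin.cons_succ,
    Fin.sum_univ_succ, and_assoc, lt_sub_iff_add_lt']

/-- The unnormalized Dirichlet density on the open simplex of size `s`. -/
noncomputable def dirichletKernel {n : ℕ} (a : Fin n → ℝ) (b s : ℝ) (x : Fin n → ℝ) : ℝ :=
  (∏ j, x j ^ (a j - 1)) * (s - ∑ j, x j) ^ (b - 1)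

@[fun_prop]
theorem measurable_dirichletKernel {n : ℕ} (a : Fin n → ℝ) (b s : ℝ) :
    Measurable (dirichletKernel a b s) := by
  unfold dirichletKernel
  fun_prop

theorem dirichletKernel_cons {n : ℕ} (a : Fin (n + 1) → ℝ) (b s t : ℝ) (x : Fin n → ℝ) :
    dirichletKernel a b s (Fin.cons t x) =
      t ^ (a 0 - 1) * dirichletKernel (fun j => a j.succ) b (s - t) x := by
  simp only [dirichletKernel, Fin.prod_univ_succ, Fin.sum_univ_succ, Fin.cons_zero, Fin.cons_succ]
  rw [sub_sub]
  ring

theorem dirichletKernel_nonneg {n : ℕ} (a : Fin n → ℝ) (b : ℝ) {s : ℝ} {x : Fin n → ℝ}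
    (hx : x ∈ openSimplex n s) : 0 ≤ dirichletKernel a b s x :=
  mul_nonneg (Finset.prod_nonneg fun j _ => Real.rpow_nonneg (hx.1 j).le _)
    (Real.rpow_nonneg (sub_nonneg.2 hx.2.le) _)

theorem lintegral_rpow_mul_sub_rpow_s8 {a b s : ℝ} (ha : 0 < a) (hb : 0 < b) (hs : 0 < s) :
    ∫⁻ t in Set.Ioo 0 s, ENNReal.ofReal (t ^ (a - 1) * (s - t) ^ (b - 1)) =
      ENNReal.ofReal (ProbabilityTheory.beta a b * s ^ (a + b - 1)) := by
  have hB := ProbabilityTheory.beta_pos ha hb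
  rw [← lintegral_indicator measurableSet_Ioo, ← Real.smul_map_volume_mul_left hs.ne',
    lintegral_smul_measure, lintegral_map
      (Measurable.indicator (by fun_prop) measurableSet_Ioo) (by fun_prop)]
  have h (u : ℝ) : (Set.Ioo 0 s).indicator
      (fun t => ENNReal.ofReal (t ^ (a - 1) * (s - t) ^ (b - 1))) (s * u) =
      ENNReal.ofReal (ProbabilityTheory.beta a b * s ^ (a + b - 2)) *
        ProbabilityTheory.betaPDF a b u := by
    have hmem : s * u ∈ Set.Ioo 0 s ↔ 0 < u ∧ u < 1 := by
      rw [Set.mem_Ioo, mul_pos_iff_of_pos_left hs, mul_lt_iff_lt_one_right hs]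
    by_cases hu : 0 < u ∧ u < 1
    · rw [Set.indicator_of_mem (hmem.2 hu), ProbabilityTheory.betaPDF_of_pos_lt_one hu.1 hu.2,
        ← ENNReal.ofReal_mul (by positivity)]
      congr 1
      rw [Real.mul_rpow hs.le hu.1.le, show s - s * u = s * (1 - u) by ring,
        Real.mul_rpow hs.le (by linarith), show a + b - 2 = (a - 1) + (b - 1) by ring,
        Real.rpow_add hs]
      field_simp
    · rw [Set.indicator_of_notMem (mt hmem.1 hu), ProbabilityTheory.betaPDF_eq, if_neg hu]
      simp
  simp_rw [h]
  rw [lintegral_const_mul' _ _ ENNReal.ofReal_ne_top,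
    ProbabilityTheory.lintegral_betaPDF_eq_one ha hb, mul_one, smul_eq_mul, abs_of_pos hs,
    ← ENNReal.ofReal_mul hs.le, show a + b - 1 = a + b - 2 + 1 by ring, Real.rpow_add_one hs.ne']
  congr 1
  ring

theorem lintegral_openSimplex_succ {n : ℕ} (a : Fin (n + 1) → ℝ) (b s : ℝ) :
    ∫⁻ x in openSimplex (n + 1) s, ENNReal.ofReal (dirichletKernel a b s x) =
      ∫⁻ t in Set.Ioo 0 s, ENNReal.ofReal (t ^ (a 0 - 1)) *
        ∫⁻ x in openSimplex n (s - t),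
          ENNReal.ofReal (dirichletKernel (fun j => a j.succ) b (s - t) x) := by
  have hF : Measurable ((openSimplex (n + 1) s).indicator
      fun x => ENNReal.ofReal (dirichletKernel a b s x)) :=
    Measurable.indicator (by fun_prop) (measurableSet_openSimplex _ _)
  let e := MeasurableEquiv.piFinSuccAbove (fun _ : Fin (n + 1) => ℝ) 0
  have he := (volume_preserving_piFinSuccAbove (fun _ : Fin (n + 1) => ℝ) 0).symm
  rw [← lintegral_indicator (measurableSet_openSimplex _ _), ← he.lintegral_comp hF,
    Measure.volume_eq_prod,
    lintegral_prod (fun z => (openSimplex (n + 1) s).indicator _ (_ : Fin (n + 1) → ℝ))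
      (hF.comp he.measurable).aemeasurable,
    ← lintegral_indicator measurableSet_Ioo]
  refine lintegral_congr fun t => ?_
  have hcons (x : Fin n → ℝ) : e.symm (t, x) = Fin.cons t x := by
    simp only [e, MeasurableEquiv.piFinSuccAbove_symm_apply, Fin.insertNthEquiv_zero]
    rfl
  change ∫⁻ x, (openSimplex (n + 1) s).indicator _ (e.symm (t, x)) = _
  simp_rw [hcons]
  by_cases ht : t ∈ Set.Ioo 0 s
  · rw [Set.indicator_of_mem ht, ← lintegral_indicator (measurableSet_openSimplex _ _),
      ← lintegral_const_mul' _ _ ENNReal.ofReal_ne_top]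
    refine lintegral_congr fun x => ?_
    by_cases hx : x ∈ openSimplex n (s - t)
    · rw [Set.indicator_of_mem (cons_mem_openSimplex.2 ⟨ht.1, hx⟩), Set.indicator_of_mem hx,
        dirichletKernel_cons, ENNReal.ofReal_mul (Real.rpow_nonneg ht.1.le _)]
    · rw [Set.indicator_of_notMem (fun h => hx (cons_mem_openSimplex.1 h).2),
        Set.indicator_of_notMem hx, mul_zero]
  · rw [Set.indicator_of_notMem ht, lintegral_eq_zero_iff' (by
      exact (hF.comp (by fun_prop)).aemeasurable)]
    refine .of_forall fun x => Set.indicator_of_notMem (fun h => ht ?_) _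
    obtain ⟨h0, hx⟩ := cons_mem_openSimplex.1 h
    refine ⟨h0, lt_of_not_ge fun hst => ?_⟩
    rwa [openSimplex_eq_empty (by linarith)] at hx

/-- The **Dirichlet integral**. -/
theorem lintegral_dirichletKernel {n : ℕ} {a : Fin n → ℝ} {b s : ℝ} (ha : ∀ j, 0 < a j)
    (hb : 0 < b) (hs : 0 < s) :
    ∫⁻ x in openSimplex n s, ENNReal.ofReal (dirichletKernel a b s x) =
      ENNReal.ofReal ((∏ j, Real.Gamma (a j)) * Real.Gamma b / Real.Gamma (∑ j, a j + b) *
        s ^ (∑ j, a j + b - 1)) := by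
  induction n generalizing s with
  | zero =>
    have : openSimplex 0 s = Set.univ := by
      ext x
      simp [openSimplex, hs]
    simp [this, dirichletKernel, Measure.volume_pi_eq_dirac (0 : Fin 0 → ℝ),
      (Real.Gamma_pos_of_pos hb).ne']
  | succ n ih =>
    have hA : 0 < ∑ j : Fin n, a j.succ + b :=
      add_pos_of_nonneg_of_pos (Finset.sum_nonneg fun j _ => (ha j.succ).le) hb
    have hG := Real.Gamma_pos_of_pos hA
    set C := (∏ j : Fin n, Real.Gamma (a j.succ)) * Real.Gamma b /
      Real.Gamma (∑ j : Fin n, a j.succ + b) with hC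
    have hC0 : 0 ≤ C := div_nonneg (mul_nonneg (Finset.prod_nonneg fun j _ =>
      (Real.Gamma_pos_of_pos (ha j.succ)).le) (Real.Gamma_pos_of_pos hb).le) hG.le
    have key (t : ℝ) (ht : t ∈ Set.Ioo 0 s) : ENNReal.ofReal (t ^ (a 0 - 1)) *
        ∫⁻ x in openSimplex n (s - t),
          ENNReal.ofReal (dirichletKernel (fun j => a j.succ) b (s - t) x) =
        ENNReal.ofReal C *
          ENNReal.ofReal (t ^ (a 0 - 1) * (s - t) ^ (∑ j : Fin n, a j.succ + b - 1)) := by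
      rw [ih (fun j => ha j.succ) (sub_pos.2 ht.2), ← hC,
        ← ENNReal.ofReal_mul (Real.rpow_nonneg ht.1.le _), ← ENNReal.ofReal_mul hC0]
      congr 1
      ring
    rw [lintegral_openSimplex_succ, setLIntegral_congr_fun measurableSet_Ioo key,
      lintegral_const_mul' _ _ ENNReal.ofReal_ne_top, lintegral_rpow_mul_sub_rpow_s8 (ha 0) hA hs,
      ← ENNReal.ofReal_mul hC0, Fin.prod_univ_succ, Fin.sum_univ_succ, add_assoc,
      ProbabilityTheory.beta, hC]
    congr 1
    field_simp

theorem piVec_castSucc {n : ℕ} (x : Fin n → ℝ) (j : Fin n) :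
    piVec (n + 1) x j.castSucc = x j := by
  simp [piVec]

theorem piVec_last {n : ℕ} (x : Fin n → ℝ) :
    piVec (n + 1) x (Fin.last n) = 1 - ∑ j, x j := by
  simp [piVec]

theorem piVec_pos {n : ℕ} {x : Fin n → ℝ} (hx : x ∈ openSimplex n 1) (j : Fin (n + 1)) :
    0 < piVec (n + 1) x j := by
  refine Fin.lastCases ?_ (fun i => ?_) j
  · rw [piVec_last]
    exact sub_pos.2 hx.2
  · rw [piVec_castSucc]
    exact hx.1 i

theorem integral_prod_piVec_rpow {n : ℕ} {a : Fin (n + 1) → ℝ} (ha : ∀ j, 0 < a j) :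
    ∫ x in openSimplex n 1, ∏ j, piVec (n + 1) x j ^ (a j - 1) =
      (∏ j, Real.Gamma (a j)) / Real.Gamma (∑ j, a j) := by
  have h (x : Fin n → ℝ) : ∏ j, piVec (n + 1) x j ^ (a j - 1) =
      dirichletKernel (fun j => a j.castSucc) (a (Fin.last n)) 1 x := by
    simp only [Fin.prod_univ_castSucc, piVec_castSucc, piVec_last, dirichletKernel]
  simp_rw [h]
  rw [integral_eq_lintegral_of_nonneg_ae
      (ae_restrict_of_forall_mem (measurableSet_openSimplex _ _)
        fun x hx => dirichletKernel_nonneg _ _ hx)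
      (measurable_dirichletKernel _ _ _).aestronglyMeasurable,
    lintegral_dirichletKernel (fun j => ha j.castSucc) (ha _) one_pos, Real.one_rpow, mul_one,
    ← Fin.prod_univ_castSucc (fun j => Real.Gamma (a j)), ← Fin.sum_univ_castSucc,
    ENNReal.toReal_ofReal]
  exact div_nonneg (Finset.prod_nonneg fun j _ => (Real.Gamma_pos_of_pos (ha j)).le)
    (Real.Gamma_pos_of_pos (Finset.sum_pos (fun j _ => ha j) Finset.univ_nonempty)).le

theorem mul_prod_rpow_sub_one {ι : Type*} [Fintype ι] [DecidableEq ι] (a p : ι → ℝ)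
    (hp : ∀ j, 0 < p j) (k : ι) :
    p k * ∏ j, p j ^ (a j - 1) = ∏ j, p j ^ (Function.update a k (a k + 1) j - 1) := by
  rw [← Finset.mul_prod_erase _ _ (Finset.mem_univ k),
    ← Finset.mul_prod_erase _ (fun j => p j ^ (Function.update a k (a k + 1) j - 1))
      (Finset.mem_univ k), ← mul_assoc, Function.update_self, add_sub_right_comm,
    Real.rpow_add_one (hp k).ne', mul_comm (p k)]
  congr 1
  refine Finset.prod_congr rfl fun j hj => ?_
  rw [Function.update_of_ne (Finset.ne_of_mem_erase hj)]

/-- **Dirichlet mean.** For each category `k`, the first moment of the `k`-th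
coordinate under the (unnormalized) Dirichlet kernel is `a k / ∑ j, a j` times the
normalizing integral. -/
theorem dirichlet_mean (K : ℕ) (hK : 2 ≤ K)
    (a : Fin K → ℝ) (ha : ∀ j, 0 < a j) :
    ∀ k : Fin K,
      (∫ x : Fin (K - 1) → ℝ in
          {x : Fin (K - 1) → ℝ | (∀ j, 0 < x j) ∧ ∑ j, x j < 1},
        piVec K x k * ∏ j : Fin K, piVec K x j ^ (a j - 1)) =
      (a k / ∑ j, a j) *
        ∫ x : Fin (K - 1) → ℝ in
            {x : Fin (K - 1) → ℝ | (∀ j, 0 < x j) ∧ ∑ j, x j < 1},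
          ∏ j : Fin K, piVec K x j ^ (a j - 1) := by
  obtain ⟨n, rfl⟩ : ∃ n, K = n + 1 := ⟨K - 1, by omega⟩
  intro k
  change ∫ x in openSimplex n 1, piVec (n + 1) x k * ∏ j, piVec (n + 1) x j ^ (a j - 1) =
    (a k / ∑ j, a j) * ∫ x in openSimplex n 1, ∏ j, piVec (n + 1) x j ^ (a j - 1)
  have ha' : ∀ j, 0 < Function.update a k (a k + 1) j := by
    intro j
    rcases eq_or_ne j k with rfl | hj
    · simpa using (ha j).trans (lt_add_one _)
    · simpa [hj] using ha j
  have hA : 0 < ∑ j, a j := Finset.sum_pos (fun j _ => ha j) Finset.univ_nonempty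
  have hsum : ∑ j, Function.update a k (a k + 1) j = ∑ j, a j + 1 := by
    rw [Finset.sum_update_of_mem (Finset.mem_univ k), ← Finset.erase_eq,
      ← Finset.add_sum_erase _ a (Finset.mem_univ k)]
    ring
  have hprod : ∏ j, Real.Gamma (Function.update a k (a k + 1) j) =
      a k * ∏ j, Real.Gamma (a j) := by
    rw [← Finset.mul_prod_erase _ _ (Finset.mem_univ k),
      ← Finset.mul_prod_erase _ (fun j => Real.Gamma (a j)) (Finset.mem_univ k),
      Function.update_self, Real.Gamma_add_one (ha k).ne', mul_assoc]
    congr 2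
    refine Finset.prod_congr rfl fun j hj => ?_
    rw [Function.update_of_ne (Finset.ne_of_mem_erase hj)]
  rw [setIntegral_congr_fun (measurableSet_openSimplex n 1)
      fun x hx => mul_prod_rpow_sub_one a (piVec (n + 1) x) (piVec_pos hx) k,
    integral_prod_piVec_rpow ha', integral_prod_piVec_rpow ha, hsum, hprod,
    Real.Gamma_add_one hA.ne', mul_div_mul_comm]
end
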